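/- arXiv:0805.4439 — 4 statements merged into one kernel-verified Lean document; each statement's English description precedes it below -/
import Mathlib

section
/- Let ρ and σ be positive Borel measures on ℝ with ∫ dρ(t)/(t²+1) < ∞ and ∫ dσ(t)/(t²+1) < ∞. Suppose ρ is purely singular with respect to Lebesgue measure (ρ = ρ_s) and σ ⊥ ρ. Let F_ρ and F_σ be Herglotz functions with representations F_ρ(z) = a₁ + b₁z + ∫ (1/(t−z) − t/(t²+1)) dρ(t) and F_σ(z) = a₂ + b₂z + ∫ (1/(t−z) − t/(t²+1)) dσ(t) (for any choices of a₁, a₂ ∈ ℝ, b₁, b₂ ≥ 0). Then lim_{y→0+} F_σ(x+iy)/F_ρ(x+iy) = 0 for ρ-almost every x ∈ ℝ. -/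
open MeasureTheory Filter Topology

/-- The Herglotz function associated with a positive Borel measure `μ` on `ℝ`
(satisfying `∫ dμ(t)/(t²+1) < ∞`) and constants `a ∈ ℝ`, `b ≥ 0`:
`F(z) = a + b z + ∫ (1/(t - z) - t/(t² + 1)) dμ(t)`. -/
noncomputable def herglotzFn (μ : Measure ℝ) (a b : ℝ) (z : ℂ) : ℂ :=
  (a : ℂ) + (b : ℂ) * z +
    ∫ t : ℝ, (((t : ℂ) - z)⁻¹ - (t : ℂ) / ((t : ℂ) ^ 2 + 1)) ∂μ

section Poisson

lemma poisson_rescale (x : ℝ) {y : ℝ} (hy : 0 < y) (t : ℝ) :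
    ((t - x) ^ 2 + y ^ 2)⁻¹ = (y ^ 2)⁻¹ * (1 + ((t - x) / y) ^ 2)⁻¹ := by
  rw [← mul_inv]
  congr 1
  field_simp
  ring

lemma integrable_inv_sub_sq_add_sq (x : ℝ) {y : ℝ} (hy : 0 < y) :
    Integrable (fun t : ℝ => ((t - x) ^ 2 + y ^ 2)⁻¹) := by
  simp_rw [poisson_rescale x hy]
  exact ((integrable_inv_one_add_sq.comp_div hy.ne').comp_sub_right x).const_mul _

lemma integral_inv_sub_sq_add_sq (x : ℝ) {y : ℝ} (hy : 0 < y) :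
    ∫ t : ℝ, ((t - x) ^ 2 + y ^ 2)⁻¹ = Real.pi / y := by
  simp_rw [poisson_rescale x hy]
  rw [integral_const_mul, integral_sub_right_eq_self (fun t : ℝ => (1 + (t / y) ^ 2)⁻¹) x,
    Measure.integral_comp_div (fun t : ℝ => (1 + t ^ 2)⁻¹) y, integral_univ_inv_one_add_sq,
    abs_of_pos hy, smul_eq_mul]
  field_simp

lemma integral_eq_zero_of_differentiableOn_of_sq_decay {q : ℂ → ℂ} {D T₀ : ℝ}
    (hq : DifferentiableOn ℂ q {w | 0 ≤ w.im}) (hint : Integrable fun t : ℝ => q t)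
    (hdecay : ∀ w : ℂ, 0 ≤ w.im → T₀ ≤ ‖w‖ → ‖q w‖ ≤ D / ‖w‖ ^ 2) :
    ∫ t : ℝ, q t = 0 := by
  have hlim := intervalIntegral_tendsto_integral hint tendsto_neg_atTop_atBot tendsto_id
  refine tendsto_nhds_unique hlim (squeeze_zero_norm' (a := fun T => 4 * D / T) ?_ ?_)
  · filter_upwards [eventually_ge_atTop T₀, eventually_gt_atTop 0] with T hT hT0
    have hrect := Complex.integral_boundary_rect_eq_zero_of_differentiableOn q
      ((-T : ℝ) : ℂ) ((T : ℂ) + T * Complex.I) (hq.mono ?_)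
    · have bound : ∀ w : ℂ, 0 ≤ w.im → T ≤ ‖w‖ → ‖q w‖ ≤ D / T ^ 2 := by
        intro w hw hTw
        have h := hdecay w hw (hT.trans hTw)
        have hD : 0 ≤ D := by
          have h0 := (norm_nonneg _).trans h
          have : 0 < ‖w‖ ^ 2 := by have := hT0.trans_le hTw; positivity
          rwa [le_div_iff₀ this, zero_mul] at h0
        exact h.trans (by gcongr)
      simp only [Complex.add_re, Complex.ofReal_re, Complex.mul_re, Complex.I_re, mul_zero,
        Complex.ofReal_im, Complex.I_im, mul_one, sub_self, add_zero, Complex.add_im,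
        Complex.mul_im, zero_add, Complex.ofReal_zero, zero_mul] at hrect
      have h1 : ‖∫ t in (-T)..T, q (t + T * Complex.I)‖ ≤ D / T ^ 2 * |T - -T| := by
        refine intervalIntegral.norm_integral_le_of_norm_le_const fun t _ => bound _ ?_ ?_
        · simpa using hT0.le
        · refine le_trans ?_ (Complex.abs_im_le_norm _)
          simp [abs_of_pos hT0]
      have h2 : ‖∫ t in (0 : ℝ)..T, q (T + t * Complex.I)‖ ≤ D / T ^ 2 * |T - 0| := by
        refine intervalIntegral.norm_integral_le_of_norm_le_const fun t ht => bound _ ?_ ?_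
        · rw [Set.uIoc_of_le hT0.le] at ht
          simpa using ht.1.le
        · refine le_trans ?_ (Complex.abs_re_le_norm _)
          simp [abs_of_pos hT0]
      have h3 : ‖∫ t in (0 : ℝ)..T, q ((-T : ℝ) + t * Complex.I)‖ ≤ D / T ^ 2 * |T - 0| := by
        refine intervalIntegral.norm_integral_le_of_norm_le_const fun t ht => bound _ ?_ ?_
        · rw [Set.uIoc_of_le hT0.le] at ht
          simpa using ht.1.le
        · refine le_trans ?_ (Complex.abs_re_le_norm _)
          simp [abs_of_pos hT0]
      have heq : ∫ t in (-T)..T, q t = (∫ t in (-T)..T, q (t + T * Complex.I)) -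
          Complex.I • (∫ t in (0 : ℝ)..T, q (T + t * Complex.I)) +
          Complex.I • (∫ t in (0 : ℝ)..T, q ((-T : ℝ) + t * Complex.I)) := by
        linear_combination hrect
      simp only [id]
      rw [heq]
      refine (norm_add_le _ _).trans ((add_le_add_left (norm_sub_le _ _) _).trans ?_)
      rw [norm_smul, norm_smul, Complex.norm_I, one_mul, one_mul]
      refine (add_le_add (add_le_add h1 h2) h3).trans (le_of_eq ?_)
      rw [sub_neg_eq_add, sub_zero, abs_of_pos hT0, abs_of_pos (by linarith)]
      field_simp
      ring
    · rintro w ⟨-, hw⟩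
      simp only [Complex.ofReal_im, Complex.add_im, Complex.mul_im, Complex.ofReal_re,
        Complex.I_im, mul_one, Complex.I_re, mul_zero, add_zero, zero_add, Set.mem_preimage,
        Set.uIcc_of_le hT0.le] at hw
      exact hw.1
  · exact tendsto_const_nhds.div_atTop tendsto_id

/-- Poisson's formula for a bounded holomorphic function on a neighbourhood of the closed upper
half plane. -/
lemma integral_poisson_mul {f : ℂ → ℂ} {δ C : ℝ} (hδ : 0 < δ)
    (hf : DifferentiableOn ℂ f {w | -δ < w.im}) (hC : ∀ w : ℂ, 0 ≤ w.im → ‖f w‖ ≤ C)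
    (x : ℝ) {y : ℝ} (hy : 0 < y) :
    Integrable (fun t : ℝ => (((t - x) ^ 2 + y ^ 2)⁻¹ : ℝ) * f t) ∧
    ∫ t : ℝ, (((t - x) ^ 2 + y ^ 2)⁻¹ : ℝ) * f t = (Real.pi / y : ℝ) * f (x + y * Complex.I) := by
  set z : ℂ := x + y * Complex.I with hz
  set z' : ℂ := x - y * Complex.I with hz'
  have hzim : z.im = y := by simp [hz]
  have hz'im : z'.im = -y := by simp [hz']
  have hopen : IsOpen {w : ℂ | -δ < w.im} := isOpen_lt continuous_const Complex.continuous_im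
  have hker : ∀ t : ℝ, ((t : ℂ) - z) * (t - z') = (((t - x) ^ 2 + y ^ 2 : ℝ) : ℂ) := by
    intro t
    push_cast
    linear_combination (norm := (rw [hz, hz']; ring_nf)) (-(y : ℂ) ^ 2) * Complex.I_sq
  have hcont : Continuous fun t : ℝ => f t := by
    refine hf.continuousOn.comp_continuous Complex.continuous_ofReal fun t => ?_
    simpa using hδ
  have hI1 : Integrable (fun t : ℝ => (((t - x) ^ 2 + y ^ 2)⁻¹ : ℝ) * f t) := by
    refine (integrable_inv_sub_sq_add_sq x hy).ofReal.mul_bdd (c := C) hcont.aestronglyMeasurable ?_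
    filter_upwards with t using hC _ (by simp)
  refine ⟨hI1, ?_⟩
  have hI2 : Integrable (fun t : ℝ => ((((t - x) ^ 2 + y ^ 2)⁻¹ : ℝ) : ℂ) * f z) :=
    (integrable_inv_sub_sq_add_sq x hy).ofReal.mul_const _
  have hq_real : ∀ t : ℝ, dslope f z t * ((t : ℂ) - z')⁻¹ =
      (((t - x) ^ 2 + y ^ 2)⁻¹ : ℝ) * f t - (((t - x) ^ 2 + y ^ 2)⁻¹ : ℝ) * f z := by
    intro t
    have hne : (t : ℂ) ≠ z := by
      intro h
      have := congrArg Complex.im h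
      rw [hzim] at this
      simp at this
      linarith
    rw [dslope_of_ne _ hne, slope_def_field, Complex.ofReal_inv, ← hker, mul_inv]
    ring
  have hzero : ∫ t : ℝ, dslope f z t * ((t : ℂ) - z')⁻¹ = 0 := by
    refine integral_eq_zero_of_differentiableOn_of_sq_decay
      (q := fun w => dslope f z w * (w - z')⁻¹) (D := 8 * C) (T₀ := 2 * ‖z‖ + 1) ?_ ?_ ?_
    · refine DifferentiableOn.mul ?_ ?_
      · refine ((Complex.differentiableOn_dslope (hopen.mem_nhds ?_)).2 hf).mono fun w hw => ?_
        · change -δ < z.im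
          linarith
        · exact (neg_lt_zero.2 hδ).trans_le hw
      · refine (differentiableOn_id.sub_const _).inv fun w hw h => ?_
        have := congrArg Complex.im (sub_eq_zero.1 h)
        change w.im = z'.im at this
        change 0 ≤ w.im at hw
        linarith
    · simp_rw [hq_real]
      exact hI1.sub hI2
    · intro w hw hwT
      have hnz' : ‖z'‖ = ‖z‖ := by
        rw [← Complex.norm_conj z]; congr 1
        rw [hz, hz']
        simp [sub_eq_add_neg]
      have hz0 := norm_nonneg z
      have h1 : ‖w‖ / 2 ≤ ‖w - z‖ := by linarith [norm_sub_norm_le w z]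
      have h2 : ‖w‖ / 2 ≤ ‖w - z'‖ := by linarith [norm_sub_norm_le w z', hnz']
      have hw0 : 0 < ‖w‖ := by linarith
      have hne : w ≠ z := by rintro rfl; linarith
      have h3 : ‖f w - f z‖ ≤ 2 * C := by
        have := hC w hw
        have := hC z (by rw [hzim]; exact hy.le)
        linarith [norm_sub_le (f w) (f z)]
      have hC0 : 0 ≤ C := (norm_nonneg _).trans (hC w hw)
      rw [dslope_of_ne _ hne, slope_def_field, norm_mul, norm_div, norm_inv, ← div_eq_mul_inv,
        div_div]
      calc ‖f w - f z‖ / (‖w - z‖ * ‖w - z'‖) ≤ 2 * C / (‖w‖ / 2 * (‖w‖ / 2)) := by gcongr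
        _ = 8 * C / ‖w‖ ^ 2 := by field_simp; ring
  simp_rw [hq_real] at hzero
  rw [integral_sub hI1 hI2, sub_eq_zero] at hzero
  rw [hzero, integral_mul_const, integral_complex_ofReal, integral_inv_sub_sq_add_sq x hy]

end Poisson

section Maximal

open scoped ENNReal

/-- Weak-type bound for the centred maximal function of a measure `τ` relative to another measure
`ρ` on the real line. -/
lemma exists_mul_measure_maximal_le : ∃ N : ℕ, ∀ (τ ρ : Measure ℝ) (s : ℝ≥0∞),
    s * ρ {x | ∃ r > 0, s * ρ (Metric.closedBall x r) < τ (Metric.closedBall x r)} ≤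
      N * τ Set.univ := by
  obtain ⟨N, c, hc, hN⟩ := HasBesicovitchCovering.no_satelliteConfig (α := ℝ)
  refine ⟨N, fun τ ρ s => ?_⟩
  set E : ℕ → Set ℝ := fun n =>
    {x | ∃ r : ℝ, 0 < r ∧ r ≤ n ∧ s * ρ (Metric.closedBall x r) < τ (Metric.closedBall x r)}
    with hE
  have hmono : Monotone E := fun m n hmn x ⟨r, h0, hr, h⟩ =>
    ⟨r, h0, hr.trans (by exact_mod_cast hmn), h⟩
  have hunion : {x | ∃ r > 0, s * ρ (Metric.closedBall x r) < τ (Metric.closedBall x r)} =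
      ⋃ n, E n := by
    ext x
    refine ⟨fun ⟨r, h0, h⟩ => ?_, fun h => ?_⟩
    · obtain ⟨n, hn⟩ := exists_nat_ge r
      exact Set.mem_iUnion.2 ⟨n, r, h0, hn, h⟩
    · obtain ⟨n, r, h0, -, h⟩ := Set.mem_iUnion.1 h
      exact ⟨r, h0, h⟩
  rw [hunion, hmono.measure_iUnion, ENNReal.mul_iSup]
  refine iSup_le fun n => ?_
  choose r h0 hr h using fun x : E n => x.2
  obtain ⟨S, hdisj, hcov⟩ := Besicovitch.exist_disjoint_covering_families hc hN
    { c := fun x : E n => (x : ℝ), r := r, rpos := h0, r_bound := n, r_le := hr }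
  simp only [Subtype.range_coe] at hdisj hcov
  have hcount : ∀ i, (S i).Countable := fun i =>
    (hdisj i).countable_of_nonempty_interior fun x _ =>
      ⟨x, Metric.ball_subset_interior_closedBall (Metric.mem_ball_self (h0 x))⟩
  have hpiece : ∀ i, s * ρ (⋃ j ∈ S i, Metric.ball (j : ℝ) (r j)) ≤ τ Set.univ := by
    intro i
    have := (hcount i).to_subtype
    calc s * ρ (⋃ j ∈ S i, Metric.ball (j : ℝ) (r j))
        ≤ s * ∑' j : S i, ρ (Metric.closedBall (j : ℝ) (r j)) := by
          gcongr
          refine (measure_biUnion_le ρ (hcount i) _).trans ?_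
          exact ENNReal.tsum_le_tsum fun j => measure_mono Metric.ball_subset_closedBall
      _ = ∑' j : S i, s * ρ (Metric.closedBall (j : ℝ) (r j)) := ENNReal.tsum_mul_left.symm
      _ ≤ ∑' j : S i, τ (Metric.closedBall (j : ℝ) (r j)) :=
          ENNReal.tsum_le_tsum fun j => (h j).le
      _ = τ (⋃ j ∈ S i, Metric.closedBall (j : ℝ) (r j)) :=
          (measure_biUnion (hcount i) (hdisj i) fun _ _ =>
            Metric.isClosed_closedBall.measurableSet).symm
      _ ≤ τ Set.univ := measure_mono (Set.subset_univ _)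
  calc s * ρ (E n) ≤ s * ∑ i, ρ (⋃ j ∈ S i, Metric.ball (j : ℝ) (r j)) := by
        gcongr
        exact (measure_mono hcov).trans (measure_iUnion_fintype_le _ _)
    _ = ∑ i, s * ρ (⋃ j ∈ S i, Metric.ball (j : ℝ) (r j)) := Finset.mul_sum _ _ _
    _ ≤ ∑ _i : Fin N, τ Set.univ := Finset.sum_le_sum fun i _ => hpiece i
    _ = N * τ Set.univ := by simp

lemma measure_ball_le_mul_of_closedBall {τ ρ : Measure ℝ} {s : ℝ≥0∞} {x : ℝ}
    (h : ∀ r > 0, τ (Metric.closedBall x r) ≤ s * ρ (Metric.closedBall x r)) (r : ℝ) :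
    τ (Metric.ball x r) ≤ s * ρ (Metric.ball x r) := by
  have hunion : Metric.ball x r = ⋃ n : ℕ, Metric.closedBall x (r - 1 / (n + 1)) := by
    ext t
    simp only [Metric.mem_ball, Set.mem_iUnion, Metric.mem_closedBall]
    refine ⟨fun ht => ?_, fun ⟨n, hn⟩ => hn.trans_lt (sub_lt_self _ Nat.one_div_pos_of_nat)⟩
    obtain ⟨n, hn⟩ := exists_nat_one_div_lt (sub_pos.2 ht)
    exact ⟨n, by linarith⟩
  have hmono : Monotone fun n : ℕ => Metric.closedBall x (r - 1 / (n + 1)) := fun m n hmn =>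
    Metric.closedBall_subset_closedBall (sub_le_sub_left (Nat.one_div_le_one_div hmn) _)
  conv_lhs => rw [hunion, hmono.measure_iUnion]
  refine iSup_le fun n => ?_
  have hpos : 0 < 1 / ((n : ℝ) + 2) := by positivity
  have hlt : 1 / ((n : ℝ) + 2) < 1 / ((n : ℝ) + 1) := by
    apply one_div_lt_one_div_of_lt <;> linarith [(n.cast_nonneg : (0 : ℝ) ≤ n)]
  rcases le_or_gt (r - 1 / ((n : ℝ) + 2)) 0 with hr | hr
  · rw [Metric.closedBall_eq_empty.2 (by linarith), measure_empty]
    exact zero_le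
  · calc τ (Metric.closedBall x (r - 1 / (n + 1)))
        ≤ τ (Metric.closedBall x (r - 1 / (n + 2))) :=
          measure_mono (Metric.closedBall_subset_closedBall (by linarith))
      _ ≤ s * ρ (Metric.closedBall x (r - 1 / (n + 2))) := h _ hr
      _ ≤ s * ρ (Metric.ball x r) := by
          gcongr
          exact Metric.closedBall_subset_ball (by linarith)

lemma setOf_lt_inv_sub_sq_add_sq (x : ℝ) {y u : ℝ} (hy : 0 < y) (hu : 0 < u) :
    {t : ℝ | u < ((t - x) ^ 2 + y ^ 2)⁻¹} = Metric.ball x (√(u⁻¹ - y ^ 2)) := by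
  ext t
  have hpos : 0 < (t - x) ^ 2 + y ^ 2 := by positivity
  change u < _ ↔ _
  rw [Metric.mem_ball, Real.dist_eq, Real.lt_sqrt (abs_nonneg _), sq_abs, lt_inv_comm₀ hu hpos,
    lt_sub_iff_add_lt]

lemma lintegral_poisson_le_of_closedBall {τ ρ : Measure ℝ} {s : ℝ≥0∞} {x y : ℝ} (hy : 0 < y)
    (h : ∀ r > 0, τ (Metric.closedBall x r) ≤ s * ρ (Metric.closedBall x r)) :
    ∫⁻ t, ENNReal.ofReal ((t - x) ^ 2 + y ^ 2)⁻¹ ∂τ ≤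
      s * ∫⁻ t, ENNReal.ofReal ((t - x) ^ 2 + y ^ 2)⁻¹ ∂ρ := by
  have hcont : Continuous fun t : ℝ => ((t - x) ^ 2 + y ^ 2)⁻¹ :=
    Continuous.inv₀ (by fun_prop) fun t => by positivity
  have hnn : ∀ t : ℝ, 0 ≤ ((t - x) ^ 2 + y ^ 2)⁻¹ := fun t => by positivity
  rw [lintegral_eq_lintegral_meas_lt τ (.of_forall hnn) hcont.aemeasurable,
    lintegral_eq_lintegral_meas_lt ρ (.of_forall hnn) hcont.aemeasurable,
    ← lintegral_const_mul s (Antitone.measurable (f := fun u => ρ {t | u < ((t - x) ^ 2 + y ^ 2)⁻¹})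
      fun u v huv => measure_mono fun t (ht : v < _) => huv.trans_lt ht)]
  refine setLIntegral_mono' measurableSet_Ioi fun u hu => ?_
  rw [setOf_lt_inv_sub_sq_add_sq x hy hu]
  exact measure_ball_le_mul_of_closedBall h _

end Maximal

section GeometricMean

lemma sin_le_two_mul_sin_half_add {a b : ℝ} (hb0 : 0 ≤ b) (hbπ : b ≤ Real.pi)
    (hs : 0 ≤ Real.sin ((a + b) / 2)) : Real.sin a ≤ 2 * Real.sin ((a + b) / 2) := by
  have h1 : Real.sin a + Real.sin b = 2 * Real.sin ((a + b) / 2) * Real.cos ((a - b) / 2) := by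
    rw [Real.sin_add_sin]
  have h2 := Real.sin_nonneg_of_nonneg_of_le_pi hb0 hbπ
  nlinarith [Real.cos_le_one ((a - b) / 2)]

/-- The branch of `√(A B)` that maps pairs of points of the upper half plane to the upper half
plane. -/
noncomputable def geomMean (A B : ℂ) : ℂ := Complex.exp ((Complex.log A + Complex.log B) / 2)

variable {A B : ℂ}

lemma norm_geomMean_sq (hA : A ≠ 0) (hB : B ≠ 0) : ‖geomMean A B‖ ^ 2 = ‖A‖ * ‖B‖ := by
  have hre : ((Complex.log A + Complex.log B) / 2).re = (Real.log ‖A‖ + Real.log ‖B‖) / 2 := by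
    rw [← Complex.log_re, ← Complex.log_re, ← Complex.add_re]
    exact Complex.div_ofNat_re _ _
  rw [geomMean, Complex.norm_exp, hre, ← Real.exp_nat_mul, Nat.cast_ofNat,
    mul_div_cancel₀ _ (two_ne_zero' ℝ), Real.exp_add, Real.exp_log (norm_pos_iff.2 hA),
    Real.exp_log (norm_pos_iff.2 hB)]

lemma ne_zero_of_im_pos {z : ℂ} (hz : 0 < z.im) : z ≠ 0 := by
  rintro rfl
  simp at hz

lemma arg_mem_Ioo_of_im_pos {z : ℂ} (hz : 0 < z.im) : z.arg ∈ Set.Ioo 0 Real.pi := by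
  refine ⟨(Complex.arg_nonneg_iff.2 hz.le).lt_of_ne fun h => ?_,
    (Complex.arg_le_pi z).lt_of_ne fun h => ?_⟩
  · exact hz.ne (Complex.arg_eq_zero_iff.1 h.symm).2.symm
  · exact hz.ne (Complex.arg_eq_pi_iff.1 h).2.symm

lemma geomMean_im : (geomMean A B).im = ‖geomMean A B‖ * Real.sin ((A.arg + B.arg) / 2) := by
  have him : ((Complex.log A + Complex.log B) / 2).im = (A.arg + B.arg) / 2 := by
    rw [← Complex.log_im, ← Complex.log_im, ← Complex.add_im]
    exact Complex.div_ofNat_im _ _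
  rw [geomMean, Complex.exp_im, Complex.norm_exp, him]

lemma sin_half_arg_add_arg_pos (hA : 0 < A.im) (hB : 0 < B.im) :
    0 < Real.sin ((A.arg + B.arg) / 2) := by
  have ha := arg_mem_Ioo_of_im_pos hA
  have hb := arg_mem_Ioo_of_im_pos hB
  exact Real.sin_pos_of_pos_of_lt_pi (by linarith [ha.1, hb.1]) (by linarith [ha.2, hb.2])

lemma geomMean_im_pos (hA : 0 < A.im) (hB : 0 < B.im) : 0 < (geomMean A B).im := by
  rw [geomMean_im]
  exact mul_pos (norm_pos_iff.2 (Complex.exp_ne_zero _)) (sin_half_arg_add_arg_pos hA hB)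

lemma mul_im_lt_geomMean_im (hA : 0 < A.im) (hB : 0 < B.im) {k : ℝ} (hk : 0 ≤ k)
    (h : k ^ 2 * ‖A‖ < ‖B‖) : k * A.im < 2 * (geomMean A B).im := by
  have hs := sin_half_arg_add_arg_pos hA hB
  have hb := arg_mem_Ioo_of_im_pos hB
  have hA0 : 0 < ‖A‖ := norm_pos_iff.2 (ne_zero_of_im_pos hA)
  have hlt : k * ‖A‖ < ‖geomMean A B‖ := by
    refine lt_of_pow_lt_pow_left₀ 2 (norm_nonneg _) ?_
    rw [norm_geomMean_sq (ne_zero_of_im_pos hA) (ne_zero_of_im_pos hB)]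
    nlinarith
  rw [geomMean_im]
  calc k * A.im = k * ‖A‖ * Real.sin A.arg := by rw [mul_assoc, Complex.norm_mul_sin_arg]
    _ ≤ k * ‖A‖ * (2 * Real.sin ((A.arg + B.arg) / 2)) := by
        gcongr
        exact sin_le_two_mul_sin_half_add hb.1.le hb.2.le hs.le
    _ < ‖geomMean A B‖ * (2 * Real.sin ((A.arg + B.arg) / 2)) := by gcongr
    _ = 2 * (‖geomMean A B‖ * Real.sin ((A.arg + B.arg) / 2)) := by ring

lemma DifferentiableOn.geomMean {f g : ℂ → ℂ} {U : Set ℂ} (hf : DifferentiableOn ℂ f U)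
    (hg : DifferentiableOn ℂ g U) (hf0 : ∀ z ∈ U, 0 < (f z).im) (hg0 : ∀ z ∈ U, 0 < (g z).im) :
    DifferentiableOn ℂ (fun z => geomMean (f z) (g z)) U :=
  (((hf.clog fun z hz => .inr (hf0 z hz).ne').add
    (hg.clog fun z hz => .inr (hg0 z hz).ne')).div_const 2).cexp

end GeometricMean

section CauchyTransform

/-- The Cauchy transform `∫ dμ(t) / (t - z)` of a measure on the real line. -/
noncomputable def cauchyTransform (μ : Measure ℝ) (z : ℂ) : ℂ := ∫ t : ℝ, ((t : ℂ) - z)⁻¹ ∂μ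

lemma ofReal_sub_ne_zero {z : ℂ} (hz : 0 < z.im) (t : ℝ) : (t : ℂ) - z ≠ 0 := fun h => by
  have := congrArg Complex.im (sub_eq_zero.1 h)
  rw [Complex.ofReal_im] at this
  exact hz.ne this

lemma norm_inv_ofReal_sub_le {z : ℂ} (hz : 0 < z.im) (t : ℝ) :
    ‖((t : ℂ) - z)⁻¹‖ ≤ z.im⁻¹ := by
  rw [norm_inv]
  refine inv_anti₀ hz ?_
  simpa [abs_of_pos hz] using Complex.abs_im_le_norm ((t : ℂ) - z)

lemma continuous_inv_ofReal_sub {z : ℂ} (hz : 0 < z.im) :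
    Continuous fun t : ℝ => ((t : ℂ) - z)⁻¹ :=
  Continuous.inv₀ (by fun_prop) (ofReal_sub_ne_zero hz)

lemma im_inv_ofReal_sub (t x y : ℝ) :
    (((t : ℂ) - (x + y * Complex.I))⁻¹).im = y * ((t - x) ^ 2 + y ^ 2)⁻¹ := by
  rw [Complex.inv_im, Complex.normSq_apply]
  simp only [Complex.sub_re, Complex.ofReal_re, Complex.add_re, Complex.mul_re, Complex.I_re,
    Complex.ofReal_im, Complex.I_im, Complex.sub_im, Complex.add_im, Complex.mul_im]
  ring

variable (μ : Measure ℝ) [IsFiniteMeasure μ]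

lemma integrable_inv_ofReal_sub {z : ℂ} (hz : 0 < z.im) :
    Integrable (fun t : ℝ => ((t : ℂ) - z)⁻¹) μ :=
  .of_bound (continuous_inv_ofReal_sub hz).aestronglyMeasurable z.im⁻¹
    (.of_forall (norm_inv_ofReal_sub_le hz))

lemma norm_cauchyTransform_le {z : ℂ} (hz : 0 < z.im) :
    ‖cauchyTransform μ z‖ ≤ μ.real Set.univ / z.im := by
  refine (norm_integral_le_of_norm_le_const (.of_forall (norm_inv_ofReal_sub_le hz))).trans ?_
  rw [div_eq_inv_mul]

lemma integrable_poisson (x : ℝ) {y : ℝ} (hy : 0 < y) :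
    Integrable (fun t : ℝ => ((t - x) ^ 2 + y ^ 2)⁻¹) μ := by
  have h := (integrable_inv_ofReal_sub μ (z := x + y * Complex.I) (by simpa using hy)).im
  simp only [RCLike.im_eq_complex_im, im_inv_ofReal_sub] at h
  exact (integrable_const_mul_iff (isUnit_iff_ne_zero.2 hy.ne') _).1 h

lemma cauchyTransform_im (x : ℝ) {y : ℝ} (hy : 0 < y) :
    (cauchyTransform μ (x + y * Complex.I)).im = y * ∫ t, ((t - x) ^ 2 + y ^ 2)⁻¹ ∂μ := by
  have h := Complex.imCLM.integral_comp_comm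
    (integrable_inv_ofReal_sub μ (z := x + y * Complex.I) (by simpa using hy))
  simp only [Complex.imCLM_apply, im_inv_ofReal_sub, integral_const_mul] at h
  exact h.symm

lemma ofReal_integral_poisson (x : ℝ) {y : ℝ} (hy : 0 < y) :
    ENNReal.ofReal (∫ t, ((t - x) ^ 2 + y ^ 2)⁻¹ ∂μ) =
      ∫⁻ t, ENNReal.ofReal ((t - x) ^ 2 + y ^ 2)⁻¹ ∂μ :=
  ofReal_integral_eq_lintegral_ofReal (integrable_poisson μ x hy) (.of_forall fun t => by positivity)

lemma cauchyTransform_im_pos [NeZero μ] {z : ℂ} (hz : 0 < z.im) :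
    0 < (cauchyTransform μ z).im := by
  rw [← Complex.re_add_im z, cauchyTransform_im μ _ hz]
  refine mul_pos hz ?_
  rw [integral_pos_iff_support_of_nonneg (fun t => by positivity) (integrable_poisson μ _ hz)]
  have : Function.support (fun t : ℝ => ((t - z.re) ^ 2 + z.im ^ 2)⁻¹) = Set.univ :=
    Function.support_eq_univ fun t => by positivity
  rw [this]
  exact Measure.measure_univ_pos.2 (NeZero.ne μ)

lemma differentiableOn_cauchyTransform :
    DifferentiableOn ℂ (cauchyTransform μ) {z | 0 < z.im} := by
  intro z (hz : 0 < z.im)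
  have hs : {w : ℂ | z.im / 2 < w.im} ∈ 𝓝 z :=
    (isOpen_lt continuous_const Complex.continuous_im).mem_nhds (half_lt_self hz)
  have hpos : ∀ w ∈ {w : ℂ | z.im / 2 < w.im}, 0 < w.im := fun w hw => (half_pos hz).trans hw
  have key := hasDerivAt_integral_of_dominated_loc_of_deriv_le (μ := μ)
    (F := fun w (t : ℝ) => ((t : ℂ) - w)⁻¹) (F' := fun w (t : ℝ) => (((t : ℂ) - w)⁻¹) ^ 2)
    (bound := fun _ => ((z.im / 2)⁻¹) ^ 2) hs ?_ (integrable_inv_ofReal_sub μ hz) ?_ ?_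
    (integrable_const _) ?_
  · exact key.2.differentiableAt.differentiableWithinAt
  · filter_upwards [hs] with w hw
    exact (continuous_inv_ofReal_sub (hpos w hw)).aestronglyMeasurable
  · exact ((continuous_inv_ofReal_sub hz).pow 2).aestronglyMeasurable
  · refine .of_forall fun t w hw => ?_
    rw [norm_pow]
    gcongr
    exact (norm_inv_ofReal_sub_le (hpos w hw) t).trans
      (inv_anti₀ (half_pos hz) (le_of_lt hw))
  · refine .of_forall fun t w hw => ?_
    have h := ((hasDerivAt_id w).const_sub (t : ℂ)).inv (ofReal_sub_ne_zero (hpos w hw) t)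
    exact h.congr_deriv (by simp)

end CauchyTransform

section WeakType

open scoped ENNReal

lemma lintegral_im_le_of_mul_norm_le {f : ℂ → ℂ} {δ C K : ℝ} (hδ : 0 < δ)
    (hf : DifferentiableOn ℂ f {w | -δ < w.im}) (hC : ∀ w : ℂ, 0 ≤ w.im → ‖f w‖ ≤ C)
    (him : ∀ t : ℝ, 0 ≤ (f t).im) (hK : ∀ y : ℝ, 0 < y → y * ‖f (y * Complex.I)‖ ≤ K) :
    ∫⁻ t : ℝ, ENNReal.ofReal (f t).im ≤ ENNReal.ofReal (Real.pi * K) := by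
  have hcont : Continuous fun t : ℝ => (f t).im := by
    refine Complex.continuous_im.comp (hf.continuousOn.comp_continuous
      Complex.continuous_ofReal fun t => ?_)
    simpa using hδ
  set g : ℕ → ℝ → ℝ := fun n t =>
    ((n : ℝ) + 1) ^ 2 * (((t - 0) ^ 2 + ((n : ℝ) + 1) ^ 2)⁻¹ * (f t).im)
    with hg
  have hpt : ∀ t, Tendsto (fun n => ENNReal.ofReal (g n t)) atTop (𝓝 (ENNReal.ofReal (f t).im)) := by
    intro t
    refine ENNReal.tendsto_ofReal ?_
    have h1 : Tendsto (fun n : ℕ => (t / ((n : ℝ) + 1)) ^ 2 + 1) atTop (𝓝 (0 ^ 2 + 1)) :=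
      ((tendsto_const_nhds.div_atTop
        (tendsto_atTop_add_const_right _ _ tendsto_natCast_atTop_atTop)).pow 2).add_const 1
    have h2 := (h1.inv₀ (by norm_num)).mul_const (f t).im
    simp only [ne_eq, OfNat.ofNat_ne_zero, not_false_eq_true, zero_pow, zero_add, inv_one,
      one_mul] at h2
    refine h2.congr fun n => ?_
    have : (0 : ℝ) < (n : ℝ) + 1 := by positivity
    rw [hg]
    field_simp
    ring
  have hbound : ∀ n, ∫⁻ t, ENNReal.ofReal (g n t) ≤ ENNReal.ofReal (Real.pi * K) := by
    intro n
    have hn : (0 : ℝ) < (n : ℝ) + 1 := by positivity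
    obtain ⟨hint, heq⟩ := integral_poisson_mul hδ hf hC 0 hn
    have hint' := hint.im
    have him' := Complex.imCLM.integral_comp_comm hint
    rw [heq] at him'
    simp only [RCLike.im_eq_complex_im, Complex.imCLM_apply, Complex.im_ofReal_mul] at hint' him'
    rw [← ofReal_integral_eq_lintegral_ofReal (hint'.const_mul _)
      (.of_forall fun t => by have := him t; positivity), integral_const_mul, him']
    refine ENNReal.ofReal_le_ofReal ?_
    have h3 := hK _ hn
    have h4 : (f ((0 : ℝ) + ((n + 1 : ℝ) : ℂ) * Complex.I)).im ≤
        ‖f (((n + 1 : ℝ) : ℂ) * Complex.I)‖ := by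
      rw [Complex.ofReal_zero, zero_add]
      exact (le_abs_self _).trans (Complex.abs_im_le_norm _)
    calc ((n : ℝ) + 1) ^ 2 *
          (Real.pi / ((n : ℝ) + 1) * (f ((0 : ℝ) + ((n + 1 : ℝ) : ℂ) * Complex.I)).im)
        = Real.pi * (((n : ℝ) + 1) * (f ((0 : ℝ) + ((n + 1 : ℝ) : ℂ) * Complex.I)).im) := by
          field_simp
      _ ≤ Real.pi * (((n : ℝ) + 1) * ‖f (((n + 1 : ℝ) : ℂ) * Complex.I)‖) := by gcongr
      _ ≤ Real.pi * K := by gcongr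
  calc ∫⁻ t : ℝ, ENNReal.ofReal (f t).im
      = ∫⁻ t, liminf (fun n => ENNReal.ofReal (g n t)) atTop :=
        lintegral_congr fun t => (hpt t).liminf_eq.symm
    _ ≤ liminf (fun n => ∫⁻ t, ENNReal.ofReal (g n t)) atTop :=
        lintegral_liminf_le fun n => by
          refine (ENNReal.continuous_ofReal.comp ?_).measurable
          refine continuous_const.mul ((Continuous.inv₀ (by fun_prop) fun t => ?_).mul hcont)
          positivity
    _ ≤ ENNReal.ofReal (Real.pi * K) :=
        (liminf_le_liminf (.of_forall hbound)).trans_eq (liminf_const _)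

lemma poisson_im_le_of_closedBall (ρ : Measure ℝ) [IsFiniteMeasure ρ] {f : ℂ → ℂ} {δ C : ℝ}
    (hδ : 0 < δ) (hf : DifferentiableOn ℂ f {w | -δ < w.im})
    (hC : ∀ w : ℂ, 0 ≤ w.im → ‖f w‖ ≤ C) (him : ∀ t : ℝ, 0 ≤ (f t).im) {k : ℝ} (hk : 0 ≤ k)
    {x y : ℝ} (hy : 0 < y)
    (h : ∀ r > 0, volume.withDensity (fun t : ℝ => ENNReal.ofReal (f t).im) (Metric.closedBall x r)
      ≤ ENNReal.ofReal (Real.pi * k) * ρ (Metric.closedBall x r)) :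
    (f (x + y * Complex.I)).im ≤ k * (cauchyTransform ρ (x + y * Complex.I)).im := by
  have hcont : Continuous fun t : ℝ => (f t).im := by
    refine Complex.continuous_im.comp (hf.continuousOn.comp_continuous
      Complex.continuous_ofReal fun t => ?_)
    simpa using hδ
  have hcontP : Continuous fun t : ℝ => ((t - x) ^ 2 + y ^ 2)⁻¹ :=
    Continuous.inv₀ (by fun_prop) fun t => by positivity
  obtain ⟨hint, heq⟩ := integral_poisson_mul hδ hf hC x hy
  have hint' := hint.im
  have him' := Complex.imCLM.integral_comp_comm hint
  rw [heq] at him'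
  simp only [RCLike.im_eq_complex_im, Complex.imCLM_apply, Complex.im_ofReal_mul] at hint' him'
  have key := lintegral_poisson_le_of_closedBall hy h
  rw [lintegral_withDensity_eq_lintegral_mul _ hcont.measurable.ennreal_ofReal
    hcontP.measurable.ennreal_ofReal] at key
  have hl : ∫⁻ t, ((fun t : ℝ => ENNReal.ofReal (f t).im) *
      fun t => ENNReal.ofReal ((t - x) ^ 2 + y ^ 2)⁻¹) t =
      ENNReal.ofReal (∫ t : ℝ, ((t - x) ^ 2 + y ^ 2)⁻¹ * (f t).im) := by
    rw [ofReal_integral_eq_lintegral_ofReal hint'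
      (.of_forall fun t => by have := him t; positivity)]
    refine lintegral_congr fun t => ?_
    rw [Pi.mul_apply, ENNReal.ofReal_mul (by positivity), mul_comm]
  have hnn : 0 ≤ ∫ t, ((t - x) ^ 2 + y ^ 2)⁻¹ ∂ρ := integral_nonneg fun t => by positivity
  rw [hl, ← ofReal_integral_poisson ρ x hy, ← ENNReal.ofReal_mul (by positivity),
    ENNReal.ofReal_le_ofReal_iff (by positivity), him'] at key
  rw [cauchyTransform_im ρ x hy]
  have hπ := Real.pi_pos
  have : Real.pi / y * (f (x + y * Complex.I)).im ≤
      Real.pi / y * (k * (y * ∫ t, ((t - x) ^ 2 + y ^ 2)⁻¹ ∂ρ)) := by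
    refine key.trans_eq ?_
    field_simp
  exact le_of_mul_le_mul_left this (by positivity)

lemma norm_geomMean_cauchyTransform_le (ρ σ : Measure ℝ) [IsFiniteMeasure ρ] [IsFiniteMeasure σ]
    [NeZero ρ] [NeZero σ] {w : ℂ} (hw : 0 < w.im) :
    ‖geomMean (cauchyTransform ρ w) (cauchyTransform σ w)‖ ≤
      √(ρ.real Set.univ * σ.real Set.univ) / w.im := by
  refine le_of_sq_le_sq ?_ (by positivity)
  rw [norm_geomMean_sq (ne_zero_of_im_pos (cauchyTransform_im_pos ρ hw))
    (ne_zero_of_im_pos (cauchyTransform_im_pos σ hw)), div_pow, Real.sq_sqrt (by positivity), sq,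
    mul_div_mul_comm]
  gcongr
  exacts [norm_cauchyTransform_le ρ hw, norm_cauchyTransform_le σ hw]

/-- Weak-type estimate for the ratio of two Cauchy transforms. -/
lemma exists_mul_measure_ratio_gt_le : ∃ N : ℕ, ∀ (ρ σ : Measure ℝ) [IsFiniteMeasure ρ]
    [IsFiniteMeasure σ] (k : ℝ), 0 < k →
    ENNReal.ofReal (Real.pi * (k / 2)) * ρ {x | ∃ y : ℝ, 0 < y ∧
      k ^ 2 * ‖cauchyTransform ρ (x + y * Complex.I)‖ < ‖cauchyTransform σ (x + y * Complex.I)‖} ≤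
      N * ENNReal.ofReal (Real.pi * √(ρ.real Set.univ * σ.real Set.univ)) := by
  obtain ⟨N, hN⟩ := exists_mul_measure_maximal_le
  refine ⟨N, fun ρ σ _ _ k hk => ?_⟩
  rcases eq_zero_or_neZero ρ with rfl | _
  · simp
  rcases eq_zero_or_neZero σ with rfl | _
  · have hempty : {x : ℝ | ∃ y : ℝ, 0 < y ∧ k ^ 2 * ‖cauchyTransform ρ (x + y * Complex.I)‖ <
        ‖cauchyTransform 0 (x + y * Complex.I)‖} = ∅ := by
      refine Set.eq_empty_of_forall_notMem fun x ⟨y, _, h⟩ => ?_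
      rw [cauchyTransform.eq_def 0, integral_zero_measure, norm_zero] at h
      exact h.not_ge (by positivity)
    rw [hempty, measure_empty, mul_zero]
    exact zero_le
  set H : ℂ → ℂ := fun w => geomMean (cauchyTransform ρ w) (cauchyTransform σ w) with hH
  have hHdiff : DifferentiableOn ℂ H {w | 0 < w.im} :=
    (differentiableOn_cauchyTransform ρ).geomMean (differentiableOn_cauchyTransform σ)
      (fun z hz => cauchyTransform_im_pos ρ hz) fun z hz => cauchyTransform_im_pos σ hz
  have hHim : ∀ w : ℂ, 0 < w.im → 0 < (H w).im := fun w hw =>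
    geomMean_im_pos (cauchyTransform_im_pos ρ hw) (cauchyTransform_im_pos σ hw)
  set M : ℝ := √(ρ.real Set.univ * σ.real Set.univ) with hM
  set ε : ℕ → ℝ := fun n => 1 / ((n : ℝ) + 1) with hε
  have hε0 : ∀ n, 0 < ε n := fun n => Nat.one_div_pos_of_nat
  set f : ℕ → ℂ → ℂ := fun n w => H (w + ε n * Complex.I) with hf
  have him_shift : ∀ n (w : ℂ), (w + ε n * Complex.I).im = w.im + ε n := fun n w => by simp
  have hfdiff : ∀ n, DifferentiableOn ℂ (f n) {w | -ε n < w.im} := fun n =>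
    hHdiff.comp (differentiableOn_id.add_const _) fun w (hw : -ε n < w.im) => by
      change 0 < (w + ε n * Complex.I).im
      rw [him_shift]
      linarith
  have hfM : ∀ n (w : ℂ), 0 ≤ w.im → ‖f n w‖ ≤ M / (w.im + ε n) := fun n w hw => by
    have h0 : 0 < (w + ε n * Complex.I).im := by
      rw [him_shift]
      linarith [hε0 n]
    have := norm_geomMean_cauchyTransform_le ρ σ h0
    rwa [him_shift] at this
  have hfC : ∀ n (w : ℂ), 0 ≤ w.im → ‖f n w‖ ≤ M / ε n := fun n w hw =>
    (hfM n w hw).trans (div_le_div_of_nonneg_left (by positivity) (hε0 n) (by linarith))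
  have hfim : ∀ n (t : ℝ), 0 ≤ (f n t).im := fun n t =>
    (hHim _ (by rw [him_shift]; simpa using hε0 n)).le
  set τ : ℕ → Measure ℝ := fun n =>
    volume.withDensity (fun t : ℝ => ENNReal.ofReal (f n t).im) with hτ
  have hτM : ∀ n, τ n Set.univ ≤ ENNReal.ofReal (Real.pi * M) := fun n => by
    rw [hτ, withDensity_apply _ MeasurableSet.univ, Measure.restrict_univ]
    refine lintegral_im_le_of_mul_norm_le (hε0 n) (hfdiff n) (hfC n) (hfim n) fun y hy => ?_
    have him : ((y : ℂ) * Complex.I).im = y := by simp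
    have h1 := hfM n (y * Complex.I) (by rw [him]; exact hy.le)
    rw [him] at h1
    calc y * ‖f n (y * Complex.I)‖ ≤ y * (M / y) := by
          gcongr
          refine h1.trans (div_le_div_of_nonneg_left (by positivity) hy ?_)
          linarith [hε0 n]
      _ = M := mul_div_cancel₀ _ hy.ne'
  set E : ℕ → Set ℝ := fun n => {x | ∃ r > 0,
    ENNReal.ofReal (Real.pi * (k / 2)) * ρ (Metric.closedBall x r) <
      τ n (Metric.closedBall x r)} with hE
  have hsub : {x : ℝ | ∃ y : ℝ, 0 < y ∧ k ^ 2 * ‖cauchyTransform ρ (x + y * Complex.I)‖ <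
      ‖cauchyTransform σ (x + y * Complex.I)‖} ⊆ ⋃ n, ⋂ m ≥ n, E m := by
    rintro x ⟨y, hy, hxy⟩
    set z : ℂ := x + y * Complex.I with hz
    have hzim : 0 < z.im := by simpa [hz] using hy
    have hlt := mul_im_lt_geomMean_im (cauchyTransform_im_pos ρ hzim)
      (cauchyTransform_im_pos σ hzim) hk.le hxy
    have htend : Tendsto (fun n => (f n z).im) atTop (𝓝 (H z).im) := by
      refine (Complex.continuous_im.tendsto _).comp (Tendsto.comp (g := H)
        (f := fun n => z + ε n * Complex.I) (y := 𝓝 z) ?_ ?_)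
      · exact (hHdiff.continuousOn.continuousAt
          ((isOpen_lt continuous_const Complex.continuous_im).mem_nhds hzim)).tendsto
      · have h0 : Tendsto (fun n => (ε n : ℂ)) atTop (𝓝 ((0 : ℝ) : ℂ)) :=
          (Complex.continuous_ofReal.tendsto _).comp tendsto_one_div_add_atTop_nhds_zero_nat
        simpa using (h0.mul_const Complex.I).const_add z
    have hev := htend.eventually_const_lt
      (show k / 2 * (cauchyTransform ρ z).im < (H z).im by linarith)
    obtain ⟨n, hn⟩ := eventually_atTop.1 hev
    refine Set.mem_iUnion.2 ⟨n, Set.mem_iInter₂.2 fun m hm => ?_⟩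
    by_contra hcon
    simp only [hE, Set.mem_ofPred_eq, not_exists, not_and, not_lt] at hcon
    exact (hn m hm).not_ge (poisson_im_le_of_closedBall ρ (hε0 m) (hfdiff m) (hfC m) (hfim m)
      (half_pos hk).le hy hcon)
  have hmono : Monotone fun n => ⋂ m ≥ n, E m := fun a b hab =>
    Set.biInter_subset_biInter_left fun m (hm : b ≤ m) => hab.trans hm
  calc _ ≤ ENNReal.ofReal (Real.pi * (k / 2)) * ρ (⋃ n, ⋂ m ≥ n, E m) := by gcongr
    _ ≤ N * ENNReal.ofReal (Real.pi * M) := by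
        rw [hmono.measure_iUnion, ENNReal.mul_iSup]
        refine iSup_le fun n => ?_
        calc _ ≤ ENNReal.ofReal (Real.pi * (k / 2)) * ρ (E n) := by
              gcongr
              exact Set.iInter₂_subset n le_rfl
          _ ≤ N * τ n Set.univ := hN (τ n) ρ _
          _ ≤ N * ENNReal.ofReal (Real.pi * M) := by gcongr; exact hτM n

end WeakType

section Boundary

open scoped ENNReal

lemma measureReal_closedBall_le_cauchyTransform_im (μ : Measure ℝ) [IsFiniteMeasure μ] (x : ℝ)
    {y : ℝ} (hy : 0 < y) :
    μ.real (Metric.closedBall x y) ≤ 2 * y * (cauchyTransform μ (x + y * Complex.I)).im := by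
  have h1 : ∫ t, (Metric.closedBall x y).indicator (fun _ => (2 * y ^ 2)⁻¹) t ∂μ ≤
      ∫ t, ((t - x) ^ 2 + y ^ 2)⁻¹ ∂μ := by
    refine integral_mono ((integrable_const _).indicator Metric.isClosed_closedBall.measurableSet)
      (integrable_poisson μ x hy) fun t => ?_
    refine Set.indicator_apply_le' (fun ht => ?_) fun _ => by positivity
    rw [Metric.mem_closedBall, Real.dist_eq] at ht
    have := sq_le_sq' (by linarith [abs_nonneg (t - x)]) ht
    rw [sq_abs] at this
    gcongr
    linarith
  rw [integral_indicator_const _ Metric.isClosed_closedBall.measurableSet, smul_eq_mul] at h1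
  rw [cauchyTransform_im μ x hy]
  calc μ.real (Metric.closedBall x y)
      = 2 * y ^ 2 * (μ.real (Metric.closedBall x y) * (2 * y ^ 2)⁻¹) := by field_simp
    _ ≤ 2 * y ^ 2 * ∫ t, ((t - x) ^ 2 + y ^ 2)⁻¹ ∂μ := by gcongr
    _ = 2 * y * (y * ∫ t, ((t - x) ^ 2 + y ^ 2)⁻¹ ∂μ) := by ring

lemma ae_tendsto_norm_cauchyTransform_atTop (ρ : Measure ℝ) [IsFiniteMeasure ρ]
    (hρ : ρ ⟂ₘ volume) :
    ∀ᵐ x : ℝ ∂ρ, Tendsto (fun y : ℝ => ‖cauchyTransform ρ (x + y * Complex.I)‖)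
      (𝓝[>] 0) atTop := by
  filter_upwards [Besicovitch.ae_tendsto_rnDeriv volume ρ, hρ.symm.rnDeriv_ae_eq_zero] with x hx h0
  rw [h0, Pi.zero_apply] at hx
  refine tendsto_atTop.2 fun C => ?_
  set K : ℝ := max C 1 with hK
  have hK0 : 0 < K := lt_max_of_lt_right one_pos
  filter_upwards [hx.eventually_lt_const (ENNReal.ofReal_pos.2 (inv_pos.2 hK0)),
    self_mem_nhdsWithin] with y hy (hy0 : 0 < y)
  have hfin : ρ (Metric.closedBall x y) ≠ ∞ := measure_ne_top _ _
  have hvol : (volume (Metric.closedBall x y) : ℝ≥0∞) ≠ 0 := by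
    rw [Real.volume_closedBall]
    exact (ENNReal.ofReal_pos.2 (by positivity)).ne'
  rw [ENNReal.div_lt_iff (.inr hvol) (.inl hfin), Real.volume_closedBall,
    ← ENNReal.ofReal_toReal hfin, ← ENNReal.ofReal_mul (by positivity),
    ENNReal.ofReal_lt_ofReal_iff_of_nonneg (by positivity), ← measureReal_def,
    lt_inv_mul_iff₀ hK0] at hy
  have h1 := measureReal_closedBall_le_cauchyTransform_im ρ x hy0
  have h2 : K < (cauchyTransform ρ (x + y * Complex.I)).im := by
    refine lt_of_mul_lt_mul_left (a := 2 * y) ?_ (by positivity)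
    linarith
  exact (le_max_left C 1).trans (h2.le.trans ((le_abs_self _).trans (Complex.abs_im_le_norm _)))

lemma ofReal_sq_add_one_ne_zero (t : ℝ) : (t : ℂ) ^ 2 + 1 ≠ 0 := by
  have : (0 : ℝ) < t ^ 2 + 1 := by positivity
  exact_mod_cast this.ne'

lemma norm_herglotz_kernel_le {t δ R : ℝ} {z : ℂ} (hδ : 0 < δ) (ht : δ ≤ ‖(t : ℂ) - z‖)
    (hz : ‖z‖ ≤ R) :
    ‖((t : ℂ) - z)⁻¹ - (t : ℂ) / ((t : ℂ) ^ 2 + 1)‖ ≤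
      ((1 + R ^ 2) / δ + R) * (t ^ 2 + 1)⁻¹ := by
  have hpos : 0 < ‖(t : ℂ) - z‖ := hδ.trans_le ht
  have hne : (t : ℂ) - z ≠ 0 := norm_pos_iff.1 hpos
  have h1 : ((t : ℂ) - z)⁻¹ - (t : ℂ) / ((t : ℂ) ^ 2 + 1) =
      ((1 + z ^ 2) / (t - z) + z) * ((t ^ 2 + 1 : ℝ) : ℂ)⁻¹ := by
    have := ofReal_sq_add_one_ne_zero t
    push_cast
    field_simp
    ring
  have hn : ‖((t ^ 2 + 1 : ℝ) : ℂ)⁻¹‖ = (t ^ 2 + 1)⁻¹ := by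
    rw [norm_inv, Complex.norm_real, Real.norm_of_nonneg (by positivity)]
  rw [h1, norm_mul, hn]
  gcongr
  refine (norm_add_le _ _).trans ?_
  rw [norm_div]
  gcongr
  refine (norm_add_le _ _).trans ?_
  rw [norm_one, norm_pow]
  gcongr

lemma exists_norm_herglotzFn_sub_cauchyTransform_le {μ : Measure ℝ}
    (hμ : Integrable (fun t : ℝ => (t ^ 2 + 1)⁻¹) μ) (a b : ℝ) {U : Set ℝ} (hU : IsOpen U)
    [IsFiniteMeasure (μ.restrict U)] {x : ℝ} (hx : x ∈ U) :
    ∃ C, ∀ y : ℝ, 0 < y → y < 1 →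
      ‖herglotzFn μ a b (x + y * Complex.I) -
        cauchyTransform (μ.restrict U) (x + y * Complex.I)‖ ≤ C := by
  obtain ⟨δ, hδ, hball⟩ := Metric.isOpen_iff.1 hU x hx
  set R : ℝ := |x| + 1 with hR
  set D : ℝ := (1 + R ^ 2) / δ + R with hD
  refine ⟨|a| + |b| * R + ‖∫ t in U, (t : ℂ) / ((t : ℂ) ^ 2 + 1) ∂μ‖ +
    D * ∫ t in Uᶜ, (t ^ 2 + 1)⁻¹ ∂μ, fun y hy hy1 => ?_⟩
  set z : ℂ := x + y * Complex.I with hz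
  have hzim : 0 < z.im := by simpa [hz] using hy
  have hzR : ‖z‖ ≤ R := by
    refine (norm_add_le _ _).trans ?_
    rw [Complex.norm_real, norm_mul, Complex.norm_I, Complex.norm_real, Real.norm_eq_abs,
      Real.norm_eq_abs, abs_of_pos hy, mul_one]
    linarith
  have hcontq : Continuous fun t : ℝ => (t : ℂ) / ((t : ℂ) ^ 2 + 1) :=
    Continuous.div (by fun_prop) (by fun_prop) ofReal_sq_add_one_ne_zero
  have hUc : ∀ t ∈ Uᶜ, ‖((t : ℂ) - z)⁻¹ - (t : ℂ) / ((t : ℂ) ^ 2 + 1)‖ ≤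
      D * (t ^ 2 + 1)⁻¹ := fun t ht => by
    refine norm_herglotz_kernel_le hδ ?_ hzR
    have h1 : δ ≤ |t - x| := by
      by_contra! h
      exact ht (hball (by rwa [Metric.mem_ball, Real.dist_eq]))
    refine h1.trans ?_
    simpa [hz] using Complex.abs_re_le_norm ((t : ℂ) - z)
  have hI1 : Integrable (fun t : ℝ => ((t : ℂ) - z)⁻¹) (μ.restrict U) :=
    integrable_inv_ofReal_sub _ hzim
  have hI2 : Integrable (fun t : ℝ => (t : ℂ) / ((t : ℂ) ^ 2 + 1)) (μ.restrict U) := by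
    refine .of_bound hcontq.aestronglyMeasurable 1 (.of_forall fun t => ?_)
    have hn : ‖(t : ℂ) ^ 2 + 1‖ = t ^ 2 + 1 := by
      rw [← Complex.ofReal_pow, ← Complex.ofReal_one, ← Complex.ofReal_add, Complex.norm_real,
        Real.norm_of_nonneg (by positivity)]
    rw [norm_div, hn, Complex.norm_real, Real.norm_eq_abs, div_le_one (by positivity)]
    nlinarith [sq_abs t, sq_nonneg (|t| - 1), abs_nonneg t]
  have hI3 : IntegrableOn (fun t : ℝ => ((t : ℂ) - z)⁻¹ - (t : ℂ) / ((t : ℂ) ^ 2 + 1)) Uᶜ μ :=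
    (hμ.integrableOn.const_mul D).mono'
      ((continuous_inv_ofReal_sub hzim).sub hcontq).aestronglyMeasurable
      ((ae_restrict_iff' hU.measurableSet.compl).2 (.of_forall hUc))
  have hI : Integrable (fun t : ℝ => ((t : ℂ) - z)⁻¹ - (t : ℂ) / ((t : ℂ) ^ 2 + 1)) μ := by
    rw [← integrableOn_univ, ← Set.union_compl_self U]
    exact IntegrableOn.union (hI1.sub hI2) hI3
  have hsplit : herglotzFn μ a b z - cauchyTransform (μ.restrict U) z =
      a + b * z - (∫ t in U, (t : ℂ) / ((t : ℂ) ^ 2 + 1) ∂μ) +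
        ∫ t in Uᶜ, (((t : ℂ) - z)⁻¹ - (t : ℂ) / ((t : ℂ) ^ 2 + 1)) ∂μ := by
    rw [herglotzFn, cauchyTransform, ← integral_add_compl hU.measurableSet hI, integral_sub hI1 hI2]
    ring
  have htail : ‖∫ t in Uᶜ, (((t : ℂ) - z)⁻¹ - (t : ℂ) / ((t : ℂ) ^ 2 + 1)) ∂μ‖ ≤
      D * ∫ t in Uᶜ, (t ^ 2 + 1)⁻¹ ∂μ := by
    rw [← integral_const_mul]
    exact norm_integral_le_of_norm_le (hμ.integrableOn.const_mul D)
      ((ae_restrict_iff' hU.measurableSet.compl).2 (.of_forall hUc))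
  rw [hsplit]
  refine (norm_add_le _ _).trans (add_le_add ((norm_sub_le _ _).trans ?_) htail)
  refine add_le_add ((norm_add_le _ _).trans ?_) le_rfl
  rw [norm_mul, Complex.norm_real, Complex.norm_real, Real.norm_eq_abs, Real.norm_eq_abs]
  gcongr

lemma measure_Ioo_lt_top_of_integrable {μ : Measure ℝ}
    (hμ : Integrable (fun t : ℝ => (t ^ 2 + 1)⁻¹) μ) (n : ℝ) : μ (Set.Ioo (-n) n) < ∞ := by
  refine (measure_mono fun t ht => ?_).trans_lt
    (hμ.measure_ge_lt_top (ε := (n ^ 2 + 1)⁻¹) (by positivity))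
  have : t ^ 2 ≤ n ^ 2 := sq_le_sq' ht.1.le ht.2.le
  change (n ^ 2 + 1)⁻¹ ≤ (t ^ 2 + 1)⁻¹
  gcongr

lemma ae_restrict_eventually_norm_herglotzFn_le {ρ σ : Measure ℝ}
    (hρint : Integrable (fun t : ℝ => (t ^ 2 + 1)⁻¹) ρ)
    (hσint : Integrable (fun t : ℝ => (t ^ 2 + 1)⁻¹) σ)
    (hρsing : ρ ⟂ₘ (volume : Measure ℝ)) (hσρ : σ ⟂ₘ ρ) (a₁ b₁ a₂ b₂ n : ℝ) {k : ℝ}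
    (hk : 0 < k) :
    ∀ᵐ x : ℝ ∂ρ.restrict (Set.Ioo (-n) n), ∀ᶠ y : ℝ in 𝓝[>] 0,
      ‖herglotzFn σ a₂ b₂ (x + y * Complex.I)‖ ≤
        2 * k ^ 2 * ‖herglotzFn ρ a₁ b₁ (x + y * Complex.I)‖ := by
  obtain ⟨N, hN⟩ := exists_mul_measure_ratio_gt_le
  set I : Set ℝ := Set.Ioo (-n) n with hI
  have : IsFiniteMeasure (ρ.restrict I) :=
    isFiniteMeasure_restrict.2 (measure_Ioo_lt_top_of_integrable hρint n).ne
  have : IsFiniteMeasure (σ.restrict I) :=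
    isFiniteMeasure_restrict.2 (measure_Ioo_lt_top_of_integrable hσint n).ne
  obtain ⟨S, hS, hσS, hρS⟩ := hσρ
  have hdiv := ae_tendsto_norm_cauchyTransform_atTop (ρ.restrict I)
    (hρsing.mono_ac Measure.restrict_le_self.absolutelyContinuous .rfl)
  set B : Set ℝ := {x | x ∈ S ∧ x ∈ I ∧
    Tendsto (fun y : ℝ => ‖cauchyTransform (ρ.restrict I) (x + y * Complex.I)‖) (𝓝[>] 0) atTop ∧
    ¬ ∀ᶠ y : ℝ in 𝓝[>] 0, ‖herglotzFn σ a₂ b₂ (x + y * Complex.I)‖ ≤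
        2 * k ^ 2 * ‖herglotzFn ρ a₁ b₁ (x + y * Complex.I)‖} with hB
  set M : ℝ := (ρ.restrict I).real Set.univ with hM
  have hbound : ∀ η : ℝ, 0 < η → ENNReal.ofReal (Real.pi * (k / 2)) * ρ.restrict I B ≤
      N * ENNReal.ofReal (Real.pi * √(M * η)) := by
    intro η hη
    obtain ⟨V, hSV, hV, hVη⟩ := Set.exists_isOpen_lt_of_lt (μ := σ.restrict I) S (ENNReal.ofReal η)
      ((Measure.restrict_le_self S).trans_lt (by rw [hσS]; exact ENNReal.ofReal_pos.2 hη))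
    set U : Set ℝ := V ∩ I with hU
    have hUo : IsOpen U := hV.inter isOpen_Ioo
    rw [Measure.restrict_apply hV.measurableSet] at hVη
    have : IsFiniteMeasure (σ.restrict U) :=
      isFiniteMeasure_restrict.2 (hVη.trans ENNReal.ofReal_lt_top).ne
    have hUη : (σ.restrict U).real Set.univ ≤ η := by
      rw [measureReal_restrict_apply_univ]
      exact ENNReal.toReal_le_of_le_ofReal hη.le hVη.le
    calc _ ≤ _ := by
          refine mul_le_mul_right (measure_mono ?_) _
          rintro x ⟨hxS, hxI, hxdiv, hxbad⟩
          by_contra hcon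
          simp only [Set.mem_ofPred_eq, not_exists, not_and, not_lt] at hcon
          obtain ⟨C₁, hC₁⟩ := exists_norm_herglotzFn_sub_cauchyTransform_le hσint a₂ b₂ hUo
            (x := x) ⟨hSV hxS, hxI⟩
          obtain ⟨C₂, hC₂⟩ := exists_norm_herglotzFn_sub_cauchyTransform_le hρint a₁ b₁
            (U := I) isOpen_Ioo hxI
          refine hxbad ?_
          filter_upwards [hxdiv.eventually_ge_atTop (C₂ + C₂ + C₁ / k ^ 2),
            Ioo_mem_nhdsGT one_pos] with y hy hy01
          have h1 := hC₁ y hy01.1 hy01.2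
          have h2 := hC₂ y hy01.1 hy01.2
          have h3 := hcon y hy01.1
          have h4 := norm_sub_norm_le (herglotzFn σ a₂ b₂ (x + y * Complex.I))
            (cauchyTransform (σ.restrict U) (x + y * Complex.I))
          have h5 := norm_sub_norm_le (cauchyTransform (ρ.restrict I) (x + y * Complex.I))
            (herglotzFn ρ a₁ b₁ (x + y * Complex.I))
          rw [norm_sub_rev] at h5
          have hk2 : 0 < k ^ 2 := by positivity
          have h6 : k ^ 2 * (C₂ + C₁ / k ^ 2) ≤
              k ^ 2 * ‖herglotzFn ρ a₁ b₁ (x + y * Complex.I)‖ := by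
            gcongr
            linarith
          have h7 : k ^ 2 * ‖cauchyTransform (ρ.restrict I) (x + y * Complex.I)‖ ≤
              k ^ 2 * (‖herglotzFn ρ a₁ b₁ (x + y * Complex.I)‖ + C₂) := by
            gcongr
            linarith
          rw [mul_add, mul_div_cancel₀ _ hk2.ne'] at h6
          linarith
      _ ≤ N * ENNReal.ofReal (Real.pi * √(M * (σ.restrict U).real Set.univ)) :=
          hN (ρ.restrict I) (σ.restrict U) k hk
      _ ≤ N * ENNReal.ofReal (Real.pi * √(M * η)) := by gcongr
  have hBzero : ρ.restrict I B = 0 := by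
    have hlim : Tendsto (fun η : ℝ => (N : ℝ≥0∞) * ENNReal.ofReal (Real.pi * √(M * η)))
        (𝓝[>] 0) (𝓝 0) := by
      have hc : Continuous fun η : ℝ => (N : ℝ≥0∞) * ENNReal.ofReal (Real.pi * √(M * η)) :=
        (ENNReal.continuous_const_mul (ENNReal.natCast_ne_top N)).comp
          (ENNReal.continuous_ofReal.comp (by fun_prop))
      simpa using (hc.tendsto 0).mono_left nhdsWithin_le_nhds
    have h0 := ge_of_tendsto hlim (eventually_nhdsWithin_of_forall hbound)
    have hpos : ENNReal.ofReal (Real.pi * (k / 2)) ≠ 0 :=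
      (ENNReal.ofReal_pos.2 (by positivity)).ne'
    exact (mul_eq_zero.1 (le_antisymm h0 zero_le)).resolve_left hpos
  have hSae : ∀ᵐ x ∂ρ.restrict I, x ∈ S := ae_restrict_of_ae (mem_ae_iff.2 hρS)
  filter_upwards [hdiv, hSae, ae_restrict_mem measurableSet_Ioo,
    measure_eq_zero_iff_ae_notMem.1 hBzero]
    with x h1 h2 h3 h4
  by_contra h5
  exact h4 ⟨h2, h3, h1, h5⟩

end Boundary

/-- Proposition 2.1: if `ρ` is purely singular (w.r.t. Lebesgue measure) and `σ ⊥ ρ`,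
then `F_σ(x+iy)/F_ρ(x+iy) → 0` as `y → 0+` for `ρ`-almost every `x`. -/
theorem ratio_tendsto_zero_of_mutuallySingular
    (ρ σ : Measure ℝ)
    (hρint : Integrable (fun t : ℝ => (t ^ 2 + 1)⁻¹) ρ)
    (hσint : Integrable (fun t : ℝ => (t ^ 2 + 1)⁻¹) σ)
    (hρsing : ρ ⟂ₘ (volume : Measure ℝ)) (hσρ : σ ⟂ₘ ρ)
    (a₁ b₁ a₂ b₂ : ℝ) (hb₁ : 0 ≤ b₁) (hb₂ : 0 ≤ b₂) :
    ∀ᵐ x : ℝ ∂ρ, Tendsto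
      (fun y : ℝ =>
        herglotzFn σ a₂ b₂ ((x : ℂ) + y * Complex.I) /
          herglotzFn ρ a₁ b₁ ((x : ℂ) + y * Complex.I))
      (𝓝[>] (0 : ℝ)) (𝓝 0) := by
  have hall : ∀ n m : ℕ, ∀ᵐ x : ℝ ∂ρ, x ∈ Set.Ioo (-(n : ℝ)) n → ∀ᶠ y : ℝ in 𝓝[>] 0,
      ‖herglotzFn σ a₂ b₂ (x + y * Complex.I)‖ ≤
        2 * (1 / ((m : ℝ) + 1)) ^ 2 * ‖herglotzFn ρ a₁ b₁ (x + y * Complex.I)‖ := fun n m =>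
    (ae_restrict_iff' measurableSet_Ioo).1 (ae_restrict_eventually_norm_herglotzFn_le hρint hσint
      hρsing hσρ a₁ b₁ a₂ b₂ n Nat.one_div_pos_of_nat)
  filter_upwards [ae_all_iff.2 fun n => ae_all_iff.2 (hall n)] with x hx
  obtain ⟨n, hn⟩ := exists_nat_gt |x|
  refine Metric.tendsto_nhds.2 fun ε hε => ?_
  have hlim : Tendsto (fun m : ℕ => 2 * (1 / ((m : ℝ) + 1)) ^ 2) atTop (𝓝 (2 * 0 ^ 2)) :=
    (tendsto_one_div_add_atTop_nhds_zero_nat.pow 2).const_mul 2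
  obtain ⟨m, hm⟩ := (hlim.eventually_lt_const (show 2 * (0 : ℝ) ^ 2 < ε by simpa)).exists
  filter_upwards [hx n m (abs_lt.1 hn)] with y hy
  rw [dist_zero_right, norm_div]
  exact (div_le_of_le_mul₀ (norm_nonneg _) (by positivity) hy).trans_lt hm
end

section
/- Let a < b be real numbers, let ξ ∈ L^∞(a,b) satisfy 0 ≤ ξ ≤ 1, and let x ∈ ℝ with x ∉ [a,b]. Define I_x(ξ) = ∫_a^b ξ(t)/(t−x) dt and set c = ∫_a^b ξ(t) dt. Then I_x(ξ) ≤ I_x(χ_{(a,a+c)}), i.e. ∫_a^b ξ(t)/(t−x) dt ≤ ∫_a^{a+c} dt/(t−x). -/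
open MeasureTheory Filter Topology

/-- The bathtub principle for antitone kernels: among densities with values in `[0, 1]` and given
mass, the integral against an antitone function is maximized by the leftmost interval. -/
theorem AntitoneOn.setIntegral_mul_le {a b : ℝ} {g ξ : ℝ → ℝ} (hab : a ≤ b)
    (hg : AntitoneOn g (Set.Icc a b)) (hξmeas : Measurable ξ)
    (hξ01 : ∀ t ∈ Set.Ioo a b, ξ t ∈ Set.Icc (0 : ℝ) 1) :
    (∫ t in Set.Ioo a b, ξ t * g t) ≤
      ∫ t in Set.Ioo a (a + ∫ t in Set.Ioo a b, ξ t), g t := by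
  have hbound : ∀ᵐ t ∂volume.restrict (Set.Ioo a b), ‖ξ t‖ ≤ 1 := by
    filter_upwards [ae_restrict_mem measurableSet_Ioo] with t ht
    rw [Real.norm_of_nonneg (hξ01 t ht).1]
    exact (hξ01 t ht).2
  have hgint : IntegrableOn g (Set.Ioo a b) :=
    (hg.integrableOn_isCompact isCompact_Icc).mono_set Set.Ioo_subset_Icc_self
  have hξint : IntegrableOn ξ (Set.Ioo a b) :=
    Measure.integrableOn_of_bounded (by simp) hξmeas.aestronglyMeasurable hbound
  have hξgint : IntegrableOn (fun t => ξ t * g t) (Set.Ioo a b) :=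
    hgint.bdd_mul hξmeas.aestronglyMeasurable hbound
  set c := ∫ t in Set.Ioo a b, ξ t with hc
  have hc0 : 0 ≤ c := setIntegral_nonneg measurableSet_Ioo fun t ht => (hξ01 t ht).1
  have hcb : c ≤ b - a := by
    have h := setIntegral_mono_on hξint (integrableOn_const (C := (1 : ℝ)) (by simp))
      measurableSet_Ioo fun t ht => (hξ01 t ht).2
    simpa [hab] using h
  have hm : a + c ∈ Set.Icc a b := ⟨by linarith, by linarith⟩
  have hsub : Set.Ioo a (a + c) ⊆ Set.Ioo a b := Set.Ioo_subset_Ioo_right hm.2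
  have hdiff : IntegrableOn (fun t => g t - g (a + c)) (Set.Ioo a b) :=
    hgint.sub (integrableOn_const (by simp))
  have key : (∫ t in Set.Ioo a b, (ξ t * g t - ξ t * g (a + c))) ≤
      ∫ t in Set.Ioo a b, (Set.Ioo a (a + c)).indicator (fun t => g t - g (a + c)) t := by
    refine setIntegral_mono_on (hξgint.sub (hξint.mul_const _))
      (hdiff.indicator measurableSet_Ioo) measurableSet_Ioo fun t ht => ?_
    obtain ⟨h0, h1⟩ := hξ01 t ht
    have htI := Set.Ioo_subset_Icc_self ht
    by_cases htm : t < a + c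
    · rw [Set.indicator_of_mem (show t ∈ Set.Ioo a (a + c) from ⟨ht.1, htm⟩)]
      nlinarith [hg htI hm htm.le]
    · rw [Set.indicator_of_notMem fun h => htm h.2]
      nlinarith [hg hm htI (not_lt.mp htm)]
  rw [integral_sub hξgint (hξint.mul_const _), integral_mul_const, ← hc,
    setIntegral_indicator measurableSet_Ioo, Set.inter_eq_right.mpr hsub,
    integral_sub (hgint.mono_set hsub) (integrableOn_const (by simp))] at key
  simp [hc0] at key
  linarith

theorem antitoneOn_one_div_sub {a b x : ℝ} (hx : x ∉ Set.Icc a b) :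
    AntitoneOn (fun t => 1 / (t - x)) (Set.Icc a b) := by
  intro s hs t ht hst
  rcases lt_or_ge x a with h | h
  · exact one_div_le_one_div_of_le (by linarith [hs.1]) (by linarith)
  · have hb : b < x := not_le.mp fun hxb => hx ⟨h, hxb⟩
    exact one_div_le_one_div_of_neg_of_le (by linarith [ht.2]) (by linarith)

/-- Lemma 2.1: for a measurable `ξ : (a,b) → [0,1]` and `x ∉ [a,b]`, the integral
`I_x(ξ) = ∫_a^b ξ(t)/(t-x) dt` satisfies `I_x(ξ) ≤ I_x(χ_{(a,a+c)})`, where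
`c = ∫_a^b ξ(t) dt`. -/
theorem integral_le_integral_front_interval
    (a b x c : ℝ) (hab : a < b) (hx : x ∉ Set.Icc a b)
    (ξ : ℝ → ℝ) (hξmeas : Measurable ξ)
    (hξ01 : ∀ t ∈ Set.Ioo a b, ξ t ∈ Set.Icc (0 : ℝ) 1)
    (hc : c = ∫ t in Set.Ioo a b, ξ t) :
    (∫ t in Set.Ioo a b, ξ t / (t - x)) ≤ ∫ t in Set.Ioo a (a + c), 1 / (t - x) := by
  subst hc
  simpa only [mul_one_div] using
    (antitoneOn_one_div_sub hx).setIntegral_mul_le hab.le hξmeas hξ01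
end

section
/- Let y > 0 and let t ∈ ℝ with 0 < |t| ≤ 2y. Then ∫₀^y |ln|1 − h/t|| dh ≤ 12 y ln(1 + y/|t|). -/
open MeasureTheory Filter Topology

lemma mul_log_le_one_sub {a : ℝ} (ha : a ≤ 1) : a * Real.log a ≤ 1 - a := by
  rcases le_or_gt 0 a with h | h
  · have := Real.log_nonpos h ha
    nlinarith
  · have h1 := Real.one_sub_inv_le_log_of_pos (neg_pos.mpr h)
    rw [Real.log_neg_eq_log] at h1
    have h2 := mul_le_mul_of_nonpos_left h1 h.le
    have h3 : a * (1 - (-a)⁻¹) = a + 1 := by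
      have := h.ne
      field_simp
      ring
    linarith

lemma neg_integral_log_one_sub_div_le {y t : ℝ} (hy : 0 ≤ y) (ht : 0 < t) :
    -∫ h in (0 : ℝ)..y, Real.log (1 - h / t) ≤ 2 * y := by
  rw [intervalIntegral.integral_comp_sub_div Real.log ht.ne' 1, integral_log]
  have h1 := mul_log_le_one_sub (a := 1 - y / t) (by linarith [div_nonneg hy ht.le])
  have h2 := mul_le_mul_of_nonneg_left h1 ht.le
  have h3 : t * (y / t) = y := by field_simp
  simp only [zero_div, sub_zero, Real.log_one, mul_zero, smul_eq_mul]
  linarith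

lemma intervalIntegrable_log_one_sub_div (t a b : ℝ) :
    IntervalIntegrable (fun h => Real.log (1 - h / t)) volume a b :=
  MeromorphicOn.intervalIntegrable_log (f := fun h : ℝ => 1 - h / t) fun x _ => by
    fun_prop

lemma log_one_sub_div_le {y t h : ℝ} (ht : t ≠ 0) (hh : 0 ≤ h) (hhy : h ≤ y) :
    Real.log (1 - h / t) ≤ Real.log (1 + y / |t|) := by
  have ht' := abs_pos.mpr ht
  have hy : 0 ≤ y / |t| := div_nonneg (hh.trans hhy) ht'.le
  rcases eq_or_ne (1 - h / t) 0 with h0 | h0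
  · rw [h0, Real.log_zero]
    exact Real.log_nonneg (by linarith)
  · rw [← Real.log_abs (1 - h / t)]
    refine Real.log_le_log (abs_pos.mpr h0) ?_
    calc |1 - h / t| ≤ |1| + |h / t| := abs_sub _ _
      _ = 1 + h / |t| := by rw [abs_one, abs_div, abs_of_nonneg hh]
      _ ≤ 1 + y / |t| := by gcongr

/-- Lemma 4.1: if `0 < |t| ≤ 2y`, then `∫₀^y |ln|1 - h/t|| dh ≤ 12 y ln(1 + y/|t|)`. -/
theorem integral_abs_log_le
    (y t : ℝ) (hy : 0 < y) (ht : t ≠ 0) (hty : |t| ≤ 2 * y) :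
    (∫ h in Set.Ioo (0 : ℝ) y, |Real.log (|1 - h / t|)|) ≤
      12 * y * Real.log (1 + y / |t|) := by
  have ht' := abs_pos.mpr ht
  set L := Real.log (1 + y / |t|) with hL
  have hL3 : 1 / 3 ≤ L := by
    have hx : 1 / 2 ≤ y / |t| := by
      rw [le_div_iff₀ ht']
      linarith
    have h1 := Real.one_sub_inv_le_log_of_pos (x := 1 + y / |t|) (by linarith)
    have h2 : (1 + y / |t|)⁻¹ ≤ (3 / 2)⁻¹ := inv_anti₀ (by norm_num) (by linarith)
    norm_num at h2
    linarith
  have hint := intervalIntegrable_log_one_sub_div t 0 y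
  simp only [Real.log_abs]
  rw [← integral_Ioc_eq_integral_Ioo, ← intervalIntegral.integral_of_le hy.le]
  have hmono : ∫ h in (0 : ℝ)..y, |Real.log (1 - h / t)| ≤
      ∫ h in (0 : ℝ)..y, (2 * L - Real.log (1 - h / t)) := by
    refine intervalIntegral.integral_mono_on hy.le hint.abs
      (intervalIntegrable_const.sub hint) fun h hh => ?_
    have := log_one_sub_div_le ht hh.1 hh.2
    exact abs_le'.mpr ⟨by linarith, by linarith⟩
  have hneg : -∫ h in (0 : ℝ)..y, Real.log (1 - h / t) ≤ 2 * y := by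
    rcases ht.lt_or_gt with hlt | hgt
    · have : 0 ≤ ∫ h in (0 : ℝ)..y, Real.log (1 - h / t) :=
        intervalIntegral.integral_nonneg hy.le fun h hh =>
          Real.log_nonneg (by linarith [div_nonpos_of_nonneg_of_nonpos hh.1 hlt.le])
      linarith
    · exact neg_integral_log_one_sub_div_le hy.le hgt
  rw [intervalIntegral.integral_sub intervalIntegrable_const hint,
    intervalIntegral.integral_const, smul_eq_mul, sub_zero] at hmono
  nlinarith
end

section
/- The function φ(t) = t/(t²+1) + ln|1 − 1/t| is Lebesgue integrable on ℝ and ∫_{−∞}^{∞} φ(t) dt = 0. -/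
open MeasureTheory Filter Topology

/-- The discontinuities of `log |1 - 1 / t|` are the null set `{0, 1}`. -/
lemma Real.log_abs_one_sub_one_div {t : ℝ} (h0 : t ≠ 0) (h1 : t ≠ 1) :
    Real.log |1 - 1 / t| = Real.log (t - 1) - Real.log t := by
  rw [Real.log_abs, ← Real.log_div (sub_ne_zero.2 h1) h0]
  congr 1
  field_simp

lemma abs_div_sq_add_one_add_log_le {t : ℝ} (ht : 2 ≤ |t|) :
    |t / (t ^ 2 + 1) + Real.log (|1 - 1 / t|)| ≤ 6 * (1 + t ^ 2)⁻¹ := by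
  have hpos : 0 < |t| := by linarith
  have h0 : t ≠ 0 := abs_pos.1 hpos
  have hsq : 4 ≤ t ^ 2 := by rw [← sq_abs]; nlinarith
  have hinv : |1 / t| ≤ 1 / 2 := by
    rw [abs_div, abs_one]
    exact one_div_le_one_div_of_le two_pos ht
  have hlog : |1 / t + Real.log (1 - 1 / t)| ≤ 2 * (1 / t) ^ 2 := by
    have h := Real.abs_log_sub_add_sum_range_le (x := 1 / t) (by linarith) 1
    simp only [Finset.sum_range_one, zero_add, pow_one, Nat.cast_zero, div_one] at h
    refine h.trans ?_
    rw [div_le_iff₀ (by linarith)]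
    norm_num only [sq_abs]
    nlinarith [sq_nonneg (1 / t)]
  have hrat : |t / (t ^ 2 + 1) - 1 / t| ≤ (1 + t ^ 2)⁻¹ := by
    have : t / (t ^ 2 + 1) - 1 / t = -(1 / t * (1 + t ^ 2)⁻¹) := by
      field_simp
      ring
    rw [this, abs_neg, abs_mul, abs_of_pos (inv_pos.2 (by positivity : 0 < 1 + t ^ 2))]
    exact mul_le_of_le_one_left (by positivity) (by linarith)
  have hquad : 2 * (1 / t) ^ 2 ≤ 5 * (1 + t ^ 2)⁻¹ := by
    rw [div_pow, one_pow, mul_one_div, ← div_eq_mul_inv, div_le_div_iff₀ (by positivity)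
      (by positivity)]
    linarith
  rw [Real.log_abs, show t / (t ^ 2 + 1) + Real.log (1 - 1 / t)
    = (t / (t ^ 2 + 1) - 1 / t) + (1 / t + Real.log (1 - 1 / t)) by ring]
  linarith [abs_add_le (t / (t ^ 2 + 1) - 1 / t) (1 / t + Real.log (1 - 1 / t))]

lemma ae_div_sq_add_one_add_log_eq :
    (fun t : ℝ => t / (t ^ 2 + 1) + Real.log |1 - 1 / t|) =ᵐ[volume]
      fun t => t / (t ^ 2 + 1) + (Real.log (t - 1) - Real.log t) := by
  filter_upwards [Measure.ae_ne volume (0 : ℝ), Measure.ae_ne volume (1 : ℝ)] with t h0 h1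
  rw [Real.log_abs_one_sub_one_div h0 h1]

lemma intervalIntegrable_div_sq_add_one_add_log (a b : ℝ) :
    IntervalIntegrable (fun t : ℝ => t / (t ^ 2 + 1) + (Real.log (t - 1) - Real.log t))
      volume a b := by
  have hrat : Continuous fun t : ℝ => t / (t ^ 2 + 1) :=
    continuous_id.div (by fun_prop) fun t => by positivity
  have hlog : IntervalIntegrable (fun t : ℝ => Real.log (t - 1)) volume a b := by
    simpa using (intervalIntegral.intervalIntegrable_log'
      (a := a - 1) (b := b - 1)).comp_sub_right 1
  exact (hrat.intervalIntegrable a b).add (hlog.sub intervalIntegral.intervalIntegrable_log')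

lemma integrable_div_sq_add_one_add_log :
    Integrable fun t : ℝ => t / (t ^ 2 + 1) + Real.log |1 - 1 / t| := by
  have hloc : LocallyIntegrable fun t : ℝ => t / (t ^ 2 + 1) + Real.log |1 - 1 / t| := by
    rw [locallyIntegrable_iff]
    intro K hK
    obtain ⟨r, hr⟩ := hK.isBounded.subset_closedBall 0
    rw [Real.closedBall_eq_Icc] at hr
    refine IntegrableOn.mono_set ?_ (hr.trans (Set.Icc_subset_uIcc))
    have h := (intervalIntegrable_iff' (by simp)).1
      (intervalIntegrable_div_sq_add_one_add_log (0 - r) (0 + r))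
    exact h.congr (ae_restrict_of_ae ae_div_sq_add_one_add_log_eq.symm)
  have hint : Integrable fun t : ℝ => 6 * (1 + t ^ 2)⁻¹ :=
    integrable_inv_one_add_sq.const_mul 6
  refine hloc.integrable_of_isBigO_atBot_atTop (g := fun t : ℝ => 6 * (1 + t ^ 2)⁻¹)
    (g' := fun t : ℝ => 6 * (1 + t ^ 2)⁻¹) ?_ (hint.integrableAtFilter _) ?_
    (hint.integrableAtFilter _)
  · refine Asymptotics.IsBigO.of_bound' ?_
    filter_upwards [eventually_le_atBot (-2)] with t ht
    exact (abs_div_sq_add_one_add_log_le (le_abs.2 (Or.inr (by linarith)))).trans (le_abs_self _)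
  · refine Asymptotics.IsBigO.of_bound' ?_
    filter_upwards [eventually_ge_atTop 2] with t ht
    exact (abs_div_sq_add_one_add_log_le (le_abs.2 (Or.inl ht))).trans (le_abs_self _)

lemma integral_div_sq_add_one_add_log (a b : ℝ) :
    ∫ t in a..b, (t / (t ^ 2 + 1) + (Real.log (t - 1) - Real.log t)) =
      (Real.log (b ^ 2 + 1) / 2 + ((b - 1) * Real.log (b - 1) - b * Real.log b)) -
        (Real.log (a ^ 2 + 1) / 2 + ((a - 1) * Real.log (a - 1) - a * Real.log a)) := by
  refine integral_eq_of_hasDerivAt_off_countable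
    (fun t : ℝ => Real.log (t ^ 2 + 1) / 2 + ((t - 1) * Real.log (t - 1) - t * Real.log t)) _
    (Set.Countable.insert 0 (Set.countable_singleton 1)) ?_ ?_
    (intervalIntegrable_div_sq_add_one_add_log a b)
  · have hsq : Continuous fun t : ℝ => Real.log (t ^ 2 + 1) :=
      Continuous.log (by fun_prop) fun t => by positivity
    have hmul : Continuous fun t : ℝ => (t - 1) * Real.log (t - 1) :=
      Real.continuous_mul_log.comp (continuous_id.sub continuous_const)
    exact ((hsq.div_const 2).add (hmul.sub Real.continuous_mul_log)).continuousOn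
  · rintro t ⟨-, ht⟩
    simp only [Set.mem_insert_iff, Set.mem_singleton_iff, not_or] at ht
    have hsq := ((((hasDerivAt_id t).pow 2).add_const 1).log
      (by simp only [id, Pi.pow_apply]; positivity)).div_const 2
    have hsub := (Real.hasDerivAt_mul_log (sub_ne_zero.2 ht.2)).comp t
      ((hasDerivAt_id t).sub_const 1)
    refine HasDerivAt.congr_deriv (hsq.add (hsub.sub (Real.hasDerivAt_mul_log ht.1))) ?_
    simp only [Nat.cast_ofNat, id, Pi.pow_apply]
    ring

lemma tendsto_integral_div_sq_add_one_add_log :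
    Tendsto (fun r : ℝ => ∫ t in -r..r, (t / (t ^ 2 + 1) + (Real.log (t - 1) - Real.log t)))
      atTop (𝓝 0) := by
  have hmul := (Real.tendsto_mul_log_one_add_div_atTop (-1)).add
    (Real.tendsto_mul_log_one_add_div_atTop 1)
  have hlog (c : ℝ) : Tendsto (fun r : ℝ => Real.log (1 + c / r)) atTop (𝓝 0) := by
    have h : Tendsto (fun r : ℝ => 1 + c / r) atTop (𝓝 1) := by
      simpa using (tendsto_const_nhds (x := (1 : ℝ))).add
        ((tendsto_const_nhds (x := c)).div_atTop tendsto_id)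
    simpa using h.log one_ne_zero
  have hlim := hmul.add ((hlog 1).sub (hlog (-1)))
  simp only [neg_add_cancel, sub_zero, add_zero] at hlim
  refine hlim.congr' ?_
  filter_upwards [eventually_gt_atTop 1] with r hr
  have h0 : r ≠ 0 := by linarith
  have hneg : Real.log (1 + -1 / r) = Real.log (r - 1) - Real.log r := by
    rw [← Real.log_div (by linarith) h0]
    congr 1
    field_simp
    ring
  have hpos : Real.log (1 + 1 / r) = Real.log (r + 1) - Real.log r := by
    rw [← Real.log_div (by linarith) h0]
    congr 1
    field_simp
  rw [integral_div_sq_add_one_add_log, hneg, hpos, Real.log_neg_eq_log,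
    show -r - 1 = -(r + 1) by ring, Real.log_neg_eq_log, neg_sq]
  ring

/-- The function `φ(t) = t/(t²+1) + ln|1 - 1/t|` is Lebesgue integrable on `ℝ` and
`∫_{-∞}^{∞} φ(t) dt = 0`. -/
theorem phi_integrable_and_integral_zero :
    Integrable (fun t : ℝ => t / (t ^ 2 + 1) + Real.log (|1 - 1 / t|)) ∧
      (∫ t : ℝ, (t / (t ^ 2 + 1) + Real.log (|1 - 1 / t|))) = 0 := by
  refine ⟨integrable_div_sq_add_one_add_log, ?_⟩
  rw [integral_congr_ae ae_div_sq_add_one_add_log_eq]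
  exact tendsto_nhds_unique (intervalIntegral_tendsto_integral
    (integrable_div_sq_add_one_add_log.congr ae_div_sq_add_one_add_log_eq)
    tendsto_neg_atTop_atBot tendsto_id) tendsto_integral_div_sq_add_one_add_log
end
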